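/- Fix (u,v,w) with w > 0, v > 0 and v + uw + w² > 0, let Φ(u,v,w) = (v + uw + w², (u+w)/√2, log w), let J = [[w, 1, u+2w], [1/√2, 0, 1/√2], [0, 0, 1/w]] be the Jacobian of Φ and J⁻¹ = [[0, √2, −w], [1, −√2 w, −(u+w)w], [0, 0, w]] its inverse. For a smooth function θ of (z¹,z²,z³), let A_θ be the 3×3 matrix with entries (A_θ)^μ_ρ = Σ_ν η^{μν} (∂²θ/∂z^ν∂z^ρ)(Φ(u,v,w)). Then: (a) for θ = z¹z² + √2 z¹ e^{z³} − (1/6)(z²)³ (= θ_{2,1}), J⁻¹ A_θ J = (1/√2)[[−u, 2, u], [0, 0, 2v], [w, 0, 3w]]; (b) for θ = ½(z¹)² + √2 z¹z² e^{z³} + z¹ e^{2z³} (= θ_{3,1}), J⁻¹ A_θ J = [[0, w, 2v + 2uw], [vw, 0, uv + 4vw], [2w², w, 2uw + 6w²]]; (c) for θ = z³ − log(z¹ − √2 z² e^{z³}) (= θ_{0,0}), J⁻¹ A_θ J = (1/v²)[[0, −3w, 2v], [vw, −2uw, uv], [0, w, 0]]. Hence the dispersionless limits of the ∂/∂t^{2,0},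 ∂/∂t^{3,0} and ∂/∂t^{0,−1} flows of the (2,1)-type RR2T coincide with the corresponding flows ∂z^α/∂t = η^{αβ}∂_x(∂θ/∂z^β) of the Principal Hierarchy of M, written in the coordinates (u,v,w). -/

import Mathlib

open Matrix

/-- Partial derivative in the first slot. -/
noncomputable def pd1 (f : ℝ → ℝ → ℝ → ℝ) : ℝ → ℝ → ℝ → ℝ :=
  fun x y z => deriv (fun t => f t y z) x

/-- Partial derivative in the second slot. -/
noncomputable def pd2 (f : ℝ → ℝ → ℝ → ℝ) : ℝ → ℝ → ℝ → ℝ :=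
  fun x y z => deriv (fun t => f x t z) y

/-- Partial derivative in the third slot. -/
noncomputable def pd3 (f : ℝ → ℝ → ℝ → ℝ) : ℝ → ℝ → ℝ → ℝ :=
  fun x y z => deriv (fun t => f x y t) z

/-- Partial derivative in the (i+1)-st variable. -/
noncomputable def pd (i : Fin 3) : (ℝ → ℝ → ℝ → ℝ) → (ℝ → ℝ → ℝ → ℝ) :=
  ![pd1, pd2, pd3] i

/-- The flat metric η, with η_{αβ} = 1 iff α + β = 4 (indices shifted to 0,1,2). -/
noncomputable def eta (a b : Fin 3) : ℝ := if (a : ℕ) + (b : ℕ) = 2 then 1 else 0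

/-- The matrix A_θ with entries (A_θ)^μ_ρ = Σ_ν η^{μν} ∂²θ/∂z^ν∂z^ρ, evaluated at (x,y,z). -/
noncomputable def Amat (θ : ℝ → ℝ → ℝ → ℝ) (x y z : ℝ) : Matrix (Fin 3) (Fin 3) ℝ :=
  Matrix.of fun μ ρ => ∑ ν : Fin 3, eta μ ν * pd ν (pd ρ θ) x y z

/-- The Jacobian J of the coordinate change Φ(u,v,w) = (v+uw+w², (u+w)/√2, log w). -/
noncomputable def Jmat (u v w : ℝ) : Matrix (Fin 3) (Fin 3) ℝ :=
  !![w, 1, u + 2*w;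
     1/Real.sqrt 2, 0, 1/Real.sqrt 2;
     0, 0, 1/w]

/-- The inverse Jacobian J⁻¹. -/
noncomputable def Jinv (u v w : ℝ) : Matrix (Fin 3) (Fin 3) ℝ :=
  !![0, Real.sqrt 2, -w;
     1, -Real.sqrt 2 * w, -(u+w)*w;
     0, 0, w]

/-- θ_{2,1}. -/
noncomputable def θ21 (x y z : ℝ) : ℝ :=
  x*y + Real.sqrt 2 * x * Real.exp z - (1/6)*y^3
/-- θ_{3,1}. -/
noncomputable def θ31 (x y z : ℝ) : ℝ :=
  (1/2)*x^2 + Real.sqrt 2 * x * y * Real.exp z + x * Real.exp (2*z)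
/-- θ_{0,0}. -/
noncomputable def θ00 (x y z : ℝ) : ℝ :=
  z - Real.log (x - Real.sqrt 2 * y * Real.exp z)

/-- The entries of `A_θ` are second partial derivatives, with rows in reversed order. -/
lemma Amat_eq_pd (θ : ℝ → ℝ → ℝ → ℝ) (x y z : ℝ) :
    Amat θ x y z =
      !![pd3 (pd1 θ) x y z, pd3 (pd2 θ) x y z, pd3 (pd3 θ) x y z;
         pd2 (pd1 θ) x y z, pd2 (pd2 θ) x y z, pd2 (pd3 θ) x y z;
         pd1 (pd1 θ) x y z, pd1 (pd2 θ) x y z, pd1 (pd3 θ) x y z] := by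
  ext i j
  fin_cases i <;> fin_cases j <;> simp [Amat, eta, pd, Fin.sum_univ_three]

lemma hasDerivAt_exp_two_mul (z : ℝ) :
    HasDerivAt (fun t => Real.exp (2 * t)) (2 * Real.exp (2 * z)) z := by
  have h := ((hasDerivAt_id' z).const_mul 2).exp
  rwa [mul_one, mul_comm] at h

lemma pd1_θ21 : pd1 θ21 = fun _ y z => y + √2 * Real.exp z := by
  ext x y z
  refine HasDerivAt.deriv (((((hasDerivAt_id' x).mul_const y).add
    (((hasDerivAt_id' x).const_mul √2).mul_const (Real.exp z))).sub_const _).congr_deriv ?_)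
  ring

lemma pd2_θ21 : pd2 θ21 = fun x y _ => x - y ^ 2 / 2 := by
  ext x y z
  refine HasDerivAt.deriv (((((hasDerivAt_id' y).const_mul x).add_const _).sub
    (((hasDerivAt_id' y).pow 3).const_mul (1 / 6))).congr_deriv ?_)
  norm_num
  ring

lemma pd3_θ21 : pd3 θ21 = fun x _ z => √2 * x * Real.exp z := by
  ext x y z
  exact ((((Real.hasDerivAt_exp z).const_mul (√2 * x)).const_add _).sub_const _).deriv

lemma Amat_θ21 (x y z : ℝ) :
    Amat θ21 x y z =
      !![√2 * Real.exp z, 0, √2 * x * Real.exp z;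
         1, -y, 0;
         0, 1, √2 * Real.exp z] := by
  have h22 : deriv (fun t : ℝ => x - t ^ 2 / 2) y = -y := by
    refine HasDerivAt.deriv
      (((((hasDerivAt_id' y).pow 2).div_const 2).const_sub x).congr_deriv ?_)
    norm_num
  rw [Amat_eq_pd, pd1_θ21, pd2_θ21, pd3_θ21]
  simp [pd1, pd2, pd3, h22]

lemma pd1_θ31 : pd1 θ31 = fun x y z => x + √2 * y * Real.exp z + Real.exp (2 * z) := by
  ext x y z
  refine HasDerivAt.deriv ((((((hasDerivAt_id' x).pow 2).const_mul (1 / 2)).add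
    ((((hasDerivAt_id' x).const_mul √2).mul_const y).mul_const (Real.exp z))).add
    ((hasDerivAt_id' x).mul_const (Real.exp (2 * z)))).congr_deriv ?_)
  norm_num
  ring

lemma pd2_θ31 : pd2 θ31 = fun x _ z => √2 * x * Real.exp z := by
  ext x y z
  refine HasDerivAt.deriv ((((((hasDerivAt_id' y).const_mul (√2 * x)).mul_const
    (Real.exp z)).const_add _).add_const _).congr_deriv ?_)
  ring

lemma pd3_θ31 :
    pd3 θ31 = fun x y z => √2 * x * y * Real.exp z + x * (2 * Real.exp (2 * z)) := by
  ext x y z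
  exact ((((Real.hasDerivAt_exp z).const_mul (√2 * x * y)).const_add _).add
    ((hasDerivAt_exp_two_mul z).const_mul x)).deriv

lemma Amat_θ31 (x y z : ℝ) :
    Amat θ31 x y z =
      !![√2 * y * Real.exp z + 2 * Real.exp (2 * z), √2 * x * Real.exp z,
          √2 * x * y * Real.exp z + x * (2 * (2 * Real.exp (2 * z)));
         √2 * Real.exp z, 0, √2 * x * Real.exp z;
         1, √2 * Real.exp z, √2 * y * Real.exp z + 2 * Real.exp (2 * z)] := by
  have h31 : deriv (fun t => x + √2 * y * Real.exp t + Real.exp (2 * t)) z =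
      √2 * y * Real.exp z + 2 * Real.exp (2 * z) :=
    ((((Real.hasDerivAt_exp z).const_mul (√2 * y)).const_add x).add
      (hasDerivAt_exp_two_mul z)).deriv
  have h33 : deriv (fun t => √2 * x * y * Real.exp t + x * (2 * Real.exp (2 * t))) z =
      √2 * x * y * Real.exp z + x * (2 * (2 * Real.exp (2 * z))) :=
    (((Real.hasDerivAt_exp z).const_mul (√2 * x * y)).add
      (((hasDerivAt_exp_two_mul z).const_mul 2).const_mul x)).deriv
  have h13 : deriv (fun t => √2 * t * y * Real.exp z + t * (2 * Real.exp (2 * z))) x =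
      √2 * y * Real.exp z + 2 * Real.exp (2 * z) := by
    refine HasDerivAt.deriv ((((((hasDerivAt_id' x).const_mul √2).mul_const y).mul_const
      (Real.exp z)).add ((hasDerivAt_id' x).mul_const (2 * Real.exp (2 * z)))).congr_deriv ?_)
    ring
  rw [Amat_eq_pd, pd1_θ31, pd2_θ31, pd3_θ31]
  simp [pd1, pd2, pd3, h31, h33, h13]

/-- The argument of the logarithm in `θ00`. -/
noncomputable def logArg (x y z : ℝ) : ℝ := x - √2 * y * Real.exp z

lemma hasDerivAt_logArg_fst (x y z : ℝ) : HasDerivAt (fun t => logArg t y z) 1 x :=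
  (hasDerivAt_id' x).sub_const _

lemma hasDerivAt_logArg_snd (x y z : ℝ) :
    HasDerivAt (fun t => logArg x t z) (-(√2 * Real.exp z)) y :=
  ((((hasDerivAt_id' y).const_mul √2).mul_const (Real.exp z)).const_sub x).congr_deriv (by ring)

lemma hasDerivAt_logArg_trd (x y z : ℝ) :
    HasDerivAt (fun t => logArg x y t) (-(√2 * y * Real.exp z)) z :=
  ((Real.hasDerivAt_exp z).const_mul (√2 * y)).const_sub x

lemma pd1_θ00 {x y z : ℝ} (h : logArg x y z ≠ 0) : pd1 θ00 x y z = -(1 / logArg x y z) :=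
  (((hasDerivAt_logArg_fst x y z).log h).const_sub z).deriv

lemma pd2_θ00 {x y z : ℝ} (h : logArg x y z ≠ 0) :
    pd2 θ00 x y z = √2 * Real.exp z / logArg x y z := by
  refine HasDerivAt.deriv
    ((((hasDerivAt_logArg_snd x y z).log h).const_sub z).congr_deriv ?_)
  ring

lemma pd3_θ00 {x y z : ℝ} (h : logArg x y z ≠ 0) :
    pd3 θ00 x y z = 1 + √2 * y * Real.exp z / logArg x y z := by
  refine HasDerivAt.deriv
    (((hasDerivAt_id' z).sub ((hasDerivAt_logArg_trd x y z).log h)).congr_deriv ?_)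
  ring

/-- Partial derivatives at a point only depend on the values where `logArg` does not vanish. -/
lemma pd_eq_of_eq_of_logArg_ne_zero {f g : ℝ → ℝ → ℝ → ℝ} {x y z : ℝ}
    (hfg : ∀ {x y z : ℝ}, logArg x y z ≠ 0 → f x y z = g x y z) (h : logArg x y z ≠ 0) :
    pd1 f x y z = pd1 g x y z ∧ pd2 f x y z = pd2 g x y z ∧ pd3 f x y z = pd3 g x y z :=
  ⟨Filter.EventuallyEq.deriv_eq
      (((hasDerivAt_logArg_fst x y z).continuousAt.eventually_ne h).mono fun _ => hfg),
    Filter.EventuallyEq.deriv_eq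
      (((hasDerivAt_logArg_snd x y z).continuousAt.eventually_ne h).mono fun _ => hfg),
    Filter.EventuallyEq.deriv_eq
      (((hasDerivAt_logArg_trd x y z).continuousAt.eventually_ne h).mono fun _ => hfg)⟩

lemma Amat_θ00 {x y z : ℝ} (h : logArg x y z ≠ 0) :
    Amat θ00 x y z = (1 / logArg x y z ^ 2) •
      !![-(√2 * y * Real.exp z), √2 * x * Real.exp z, √2 * x * y * Real.exp z;
         -(√2 * Real.exp z), 2 * Real.exp z ^ 2, √2 * x * Real.exp z;
         1, -(√2 * Real.exp z), -(√2 * y * Real.exp z)] := by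
  have hs : √2 ^ 2 = (2 : ℝ) := Real.sq_sqrt zero_le_two
  have hx : x = logArg x y z + √2 * y * Real.exp z := by simp [logArg]
  obtain ⟨h11, h21, h31⟩ := pd_eq_of_eq_of_logArg_ne_zero
    (g := fun x y z => -(1 / logArg x y z)) pd1_θ00 h
  obtain ⟨h12, h22, h32⟩ := pd_eq_of_eq_of_logArg_ne_zero
    (g := fun x y z => √2 * Real.exp z / logArg x y z) pd2_θ00 h
  obtain ⟨h13, h23, h33⟩ := pd_eq_of_eq_of_logArg_ne_zero
    (g := fun x y z => 1 + √2 * y * Real.exp z / logArg x y z) pd3_θ00 h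
  have d1 := hasDerivAt_logArg_fst x y z
  have d2 := hasDerivAt_logArg_snd x y z
  have d3 := hasDerivAt_logArg_trd x y z
  have e := Real.hasDerivAt_exp z
  have k11 := ((hasDerivAt_const x (1 : ℝ)).fun_div d1 h).fun_neg.deriv
  have k21 := ((hasDerivAt_const y (1 : ℝ)).fun_div d2 h).fun_neg.deriv
  have k31 := ((hasDerivAt_const z (1 : ℝ)).fun_div d3 h).fun_neg.deriv
  have k12 := ((hasDerivAt_const x (√2 * Real.exp z)).fun_div d1 h).deriv
  have k22 := ((hasDerivAt_const y (√2 * Real.exp z)).fun_div d2 h).deriv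
  have k32 := ((e.const_mul √2).fun_div d3 h).deriv
  have k13 := (((hasDerivAt_const x (√2 * y * Real.exp z)).fun_div d1 h).const_add 1).deriv
  have k23 := (((((hasDerivAt_id' y).const_mul √2).mul_const (Real.exp z)).fun_div d2
    h).const_add 1).deriv
  have k33 := (((e.const_mul (√2 * y)).fun_div d3 h).const_add 1).deriv
  rw [Amat_eq_pd, h11, h21, h31, h12, h22, h32, h13, h23, h33]
  simp only [pd1, pd2, pd3, k11, k21, k31, k12, k22, k32, k13, k23, k33]
  generalize logArg x y z = D at h hx ⊢
  subst hx
  ext i j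
  fin_cases i <;> fin_cases j <;> simp <;> field_simp
  grind

/-- the dispersionless limits of the ∂/∂t^{2,0}, ∂/∂t^{3,0} and ∂/∂t^{0,−1}
flows of the (2,1)-type RR2T coincide with the corresponding Principal Hierarchy flows of M,
written in the coordinates (u,v,w). -/
theorem principal_hierarchy_flows_in_uvw (u v w : ℝ) (hw : 0 < w) (hv : 0 < v)
    (hd : 0 < v + u*w + w^2) :
    Jinv u v w * Amat θ21 (v + u*w + w^2) ((u+w)/Real.sqrt 2) (Real.log w) * Jmat u v w
      = (1/Real.sqrt 2) • !![-u, 2, u; 0, 0, 2*v; w, 0, 3*w]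
    ∧ Jinv u v w * Amat θ31 (v + u*w + w^2) ((u+w)/Real.sqrt 2) (Real.log w) * Jmat u v w
      = !![0, w, 2*v + 2*u*w; v*w, 0, u*v + 4*v*w; 2*w^2, w, 2*u*w + 6*w^2]
    ∧ Jinv u v w * Amat θ00 (v + u*w + w^2) ((u+w)/Real.sqrt 2) (Real.log w) * Jmat u v w
      = (1/v^2) • !![0, -3*w, 2*v; v*w, -2*u*w, u*v; 0, w, 0] := by
  have hs : √2 ^ 2 = (2 : ℝ) := Real.sq_sqrt zero_le_two
  have he : Real.exp (Real.log w) = w := Real.exp_log hw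
  have he2 : Real.exp (2 * Real.log w) = w ^ 2 := by rw [two_mul, Real.exp_add, he, sq]
  have hD : logArg (v + u*w + w^2) ((u+w)/√2) (Real.log w) = v := by
    rw [logArg, he]
    field_simp
    ring
  refine ⟨?_, ?_, ?_⟩
  · rw [Amat_θ21, he]
    ext i j
    fin_cases i <;> fin_cases j <;>
      simp [Jinv, Jmat, Matrix.mul_apply, Fin.sum_univ_three] <;> field_simp <;> grind
  · rw [Amat_θ31, he, he2]
    ext i j
    fin_cases i <;> fin_cases j <;>
      simp [Jinv, Jmat, Matrix.mul_apply, Fin.sum_univ_three] <;> field_simp <;> grind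
  · rw [Amat_θ00 (by rw [hD]; exact hv.ne'), hD, he]
    ext i j
    fin_cases i <;> fin_cases j <;>
      simp [Jinv, Jmat, Matrix.mul_apply, Fin.sum_univ_three] <;> field_simp <;> grind
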